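/- arXiv:2210.07326 — 2 statements merged into one kernel-verified Lean document; each statement's English description precedes it below -/
import Mathlib

section
/- Let q_p ∈ ℝ and c_p > 0, and let Ω be the right parabolic region Ω = {x + iy ∈ ℂ : y² < (2/c_p)·(x − q_p)}. A real n×n matrix A has all of its complex eigenvalues in Ω if and only if A = (J − R)Q for some real n×n matrices J, R, Q with Jᵀ = −J, Rᵀ = R, Q symmetric positive definite, and such that the real symmetric 2n×2n block matrix [[Q⁻¹, −√(c_p/2)·J], [√(c_p/2)·J, −q_p·Q⁻¹ − R]] is positive definite. -/
open Matrix

/-- The block matrix whose positive definiteness is the linear matrix inequality in `X` that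
characterizes the location of the eigenvalues of `A` in a parabolic region. -/
noncomputable def parabolaBlock {𝕜 m : Type*} [RCLike 𝕜] [Fintype m] (s q : ℝ)
    (A X : Matrix m m 𝕜) : Matrix (m ⊕ m) (m ⊕ m) 𝕜 :=
  fromBlocks X (-((s / 2) • (A * X - X * Aᴴ))) ((s / 2) • (A * X - X * Aᴴ))
    ((1 / 2 : ℝ) • (A * X + X * Aᴴ) - q • X)

theorem parabolaBlock_isHermitian {𝕜 m : Type*} [RCLike 𝕜] [Fintype m] (s q : ℝ)
    (A : Matrix m m 𝕜) {X : Matrix m m 𝕜} (hX : X.IsHermitian) :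
    (parabolaBlock s q A X).IsHermitian := by
  have hX' : Xᴴ = X := hX
  rw [parabolaBlock, IsHermitian, fromBlocks_conjTranspose]
  congr 1
  · simp only [conjTranspose_smul, conjTranspose_sub, conjTranspose_mul,
      conjTranspose_conjTranspose, hX', star_trivial, ← smul_neg, neg_sub]
  · simp only [← smul_neg, neg_sub, conjTranspose_smul, conjTranspose_sub, conjTranspose_mul,
      conjTranspose_conjTranspose, hX', star_trivial, ← smul_neg, neg_sub]
  · simp only [conjTranspose_smul, conjTranspose_sub, conjTranspose_add, conjTranspose_mul,
      conjTranspose_conjTranspose, hX', star_trivial]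
    rw [add_comm]

theorem parabolaBlock_conj {𝕜 m : Type*} [RCLike 𝕜] [Fintype m] [DecidableEq m] (s q : ℝ)
    {A B T : Matrix m m 𝕜} (h : A * T = T * B) :
    parabolaBlock s q A (T * Tᴴ) =
      fromBlocks T 0 0 T * parabolaBlock s q B 1 * (fromBlocks T 0 0 T)ᴴ := by
  have h1 : A * (T * Tᴴ) = T * B * Tᴴ := by rw [← Matrix.mul_assoc, h]
  have h2 : T * Tᴴ * Aᴴ = T * Bᴴ * Tᴴ := by
    rw [Matrix.mul_assoc, ← conjTranspose_mul, h, conjTranspose_mul, Matrix.mul_assoc]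
  simp only [parabolaBlock, fromBlocks_conjTranspose, fromBlocks_multiply, h1, h2]
  simp [Matrix.mul_sub, Matrix.sub_mul, Matrix.mul_add, Matrix.add_mul]

section

open scoped ComplexOrder

theorem Matrix.PosDef.map_re {m : Type*} [Fintype m] {M : Matrix m m ℂ} (hM : M.PosDef) :
    (M.map Complex.re).PosDef := by
  refine PosDef.of_dotProduct_mulVec_pos ?_ fun x hx => ?_
  · ext i j
    have := congrArg Complex.re (hM.1.apply i j)
    simpa using this
  · have hx' : (fun i => (x i : ℂ)) ≠ 0 := fun h => hx (by
      ext i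
      simpa using congrFun h i)
    have := hM.re_dotProduct_pos hx'
    simpa [dotProduct, mulVec, Finset.mul_sum] using this

theorem Matrix.PosDef.map_ofReal {m : Type*} [Fintype m] [DecidableEq m] {M : Matrix m m ℝ}
    (hM : M.PosDef) : (M.map Complex.ofReal).PosDef := by
  refine PosDef.of_dotProduct_mulVec_pos ?_ fun x hx => ?_
  · ext i j
    have := hM.1.apply i j
    simpa using this
  · have key : star x ⬝ᵥ (M.map Complex.ofReal) *ᵥ x =
        ((((fun i => (x i).re) ⬝ᵥ M *ᵥ fun i => (x i).re) +
          ((fun i => (x i).im) ⬝ᵥ M *ᵥ fun i => (x i).im) : ℝ) : ℂ) := by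
      have hsymm : ((fun i => (x i).re) ⬝ᵥ M *ᵥ fun i => (x i).im) =
          ((fun i => (x i).im) ⬝ᵥ M *ᵥ fun i => (x i).re) := by
        have ht : Mᵀ = M := hM.1
        rw [dotProduct_mulVec, ← mulVec_transpose, ht, dotProduct_comm]
      apply Complex.ext
      · simp [dotProduct, mulVec, Finset.mul_sum, Finset.sum_add_distrib]
      · simp only [dotProduct, mulVec] at hsymm
        simp [dotProduct, mulVec, Finset.sum_add_distrib, hsymm]
    rw [key, Complex.zero_lt_real]
    by_cases hre : (fun i => (x i).re) = 0
    · have him : (fun i => (x i).im) ≠ 0 := fun h => hx (by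
        ext i
        exact Complex.ext (congrFun hre i) (congrFun h i))
      exact add_pos_of_nonneg_of_pos (hM.posSemidef.dotProduct_mulVec_nonneg _)
        (hM.dotProduct_mulVec_pos him)
    · exact add_pos_of_pos_of_nonneg (hM.dotProduct_mulVec_pos hre)
        (hM.posSemidef.dotProduct_mulVec_nonneg _)

theorem Matrix.PosDef.eventually_posDef {E m : Type*} [TopologicalSpace E] [Fintype m]
    {N : E → Matrix m m ℂ} (hN : Continuous N) (hH : ∀ x, (N x).IsHermitian) {x₀ : E}
    (h₀ : (N x₀).PosDef) : ∀ᶠ x in nhds x₀, (N x).PosDef := by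
  have hcont : Continuous fun p : E × (m → ℂ) => (star p.2 ⬝ᵥ N p.1 *ᵥ p.2).re := by
    fun_prop
  have hsphere : ∀ᶠ x in nhds x₀, ∀ z ∈ Metric.sphere (0 : m → ℂ) 1,
      0 < (star z ⬝ᵥ N x *ᵥ z).re := by
    refine (isCompact_sphere (0 : m → ℂ) 1).eventually_forall_of_forall_eventually
      fun z hz => ?_
    refine hcont.continuousAt.eventually (lt_mem_nhds ?_)
    exact h₀.re_dotProduct_pos (ne_zero_of_mem_unit_sphere ⟨z, hz⟩)
  filter_upwards [hsphere] with x hx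
  refine PosDef.of_dotProduct_mulVec_pos (hH x) fun z hz => ?_
  have him : (star z ⬝ᵥ N x *ᵥ z).im = 0 := (hH x).im_star_dotProduct_mulVec_self z
  have hpos := hx (((‖z‖⁻¹ : ℝ)) • z) (by simp [norm_smul, hz])
  have hn : 0 < ‖z‖ := norm_pos_iff.2 hz
  rw [star_smul, mulVec_smul, smul_dotProduct, dotProduct_smul, Complex.smul_re,
    Complex.smul_re] at hpos
  simp only [star_trivial, smul_eq_mul] at hpos
  have : 0 < (star z ⬝ᵥ N x *ᵥ z).re := by
    have hi : 0 < ‖z‖⁻¹ := inv_pos.2 hn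
    exact pos_of_mul_pos_right (pos_of_mul_pos_right hpos hi.le) hi.le
  exact Complex.pos_iff.2 ⟨this, him.symm⟩

/-- Over `ℂ`, every endomorphism has a matrix arbitrarily close to a fixed diagonal matrix of
eigenvalues. -/
theorem Module.End.exists_basis_near_diagonal {V : Type*} [AddCommGroup V] [Module ℂ V]
    [FiniteDimensional ℂ V] {n : ℕ} (hn : Module.finrank ℂ V = n) (f : Module.End ℂ V) :
    ∃ d : Fin n → ℂ, (∀ j, f.HasEigenvalue (d j)) ∧ ∀ ε : ℝ, 0 < ε →
      ∃ b : Module.Basis (Fin n) ℂ V, ∀ i j, ‖b.repr (f (b j) - d j • b j) i‖ < ε := by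
  induction n generalizing V with
  | zero =>
    exact ⟨0, fun j => j.elim0, fun _ _ => ⟨Module.finBasisOfFinrankEq ℂ V hn, fun i => i.elim0⟩⟩
  | succ n ih =>
    have : Nontrivial V := Module.nontrivial_of_finrank_pos (R := ℂ) (by omega)
    obtain ⟨μ, hμ⟩ := f.exists_eigenvalue
    have hlt : LinearMap.range (f - μ • (1 : Module.End ℂ V)) < ⊤ := by
      rw [lt_top_iff_ne_top, ne_eq, LinearMap.range_eq_top,
        ← LinearMap.injective_iff_surjective, ← LinearMap.ker_eq_bot]
      intro h
      apply hμ
      exact (Module.End.eigenspace_def).trans h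
    obtain ⟨φ, hφ, hle⟩ := Submodule.exists_le_ker_of_lt_top _ hlt
    have hmem (v : V) : f v - μ • v ∈ LinearMap.ker φ := hle ⟨v, by simp⟩
    have hinv : ∀ v ∈ LinearMap.ker φ, f v ∈ LinearMap.ker φ := fun v hv => by
      simpa using add_mem (hmem v) (Submodule.smul_mem _ μ hv)
    have hrank : Module.finrank ℂ (LinearMap.ker φ) = n := by
      have := Module.Dual.finrank_ker_add_one_of_ne_zero hφ
      omega
    obtain ⟨d, hd, hb⟩ := ih hrank (f.restrict hinv)
    obtain ⟨y, hy⟩ : ∃ y, φ y ≠ 0 := by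
      by_contra! h
      exact hφ (LinearMap.ext h)
    refine ⟨Fin.cons μ d, fun j => ?_, fun ε hε => ?_⟩
    · refine Fin.cases hμ (fun j => ?_) j
      obtain ⟨v, hv⟩ := (hd j).exists_hasEigenvector
      refine Module.End.hasEigenvalue_of_hasEigenvector (x := (v : V))
        ⟨Module.End.mem_eigenspace_iff.2 ?_, fun h => hv.2 (Subtype.ext h)⟩
      simpa using congrArg Subtype.val hv.apply_eq_smul
    · obtain ⟨b, hb⟩ := hb ε hε
      let w : LinearMap.ker φ := ⟨f y - μ • y, hmem y⟩
      obtain ⟨t, ht0, ht⟩ : ∃ t : ℝ, 0 < t ∧ ∀ i, t * ‖b.repr w i‖ < ε := by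
        refine ⟨ε / (1 + ∑ i, ‖b.repr w i‖), by positivity, fun i => ?_⟩
        have h1 : ‖b.repr w i‖ ≤ ∑ i, ‖b.repr w i‖ :=
          Finset.single_le_sum (f := fun i => ‖b.repr w i‖) (fun _ _ => norm_nonneg _)
            (Finset.mem_univ i)
        rw [div_mul_eq_mul_div, div_lt_iff₀ (by positivity)]
        nlinarith
      have hyt : φ ((t : ℂ) • y) ≠ 0 := by simp [hy, ht0.ne']
      let c : Module.Basis (Fin (n + 1)) ℂ V := Module.Basis.mkFinCons ((t : ℂ) • y) b
        (fun a x hx h => by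
          have := congrArg φ h
          rw [map_add, map_smul, LinearMap.mem_ker.1 hx, add_zero, map_zero, smul_eq_mul] at this
          exact (mul_eq_zero.1 this).resolve_right hyt)
        (fun z => ⟨-(φ z / φ ((t : ℂ) • y)), by
          rw [LinearMap.mem_ker, map_add, map_smul, smul_eq_mul]
          field_simp
          ring⟩)
      have hc0 : c 0 = (t : ℂ) • y := by simp [c]
      have hcs (i : Fin n) : c i.succ = b i := by simp [c]
      have hrepr (v : LinearMap.ker φ) (i : Fin (n + 1)) :
          c.repr (v : V) i = (Fin.cons 0 (b.repr v) : Fin (n + 1) → ℂ) i := by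
        have hv : (v : V) = ∑ i, (Fin.cons 0 (b.repr v) : Fin (n + 1) → ℂ) i • c i := by
          rw [Fin.sum_univ_succ]
          simp only [Fin.cons_zero, Fin.cons_succ, hcs, zero_smul, zero_add]
          have := congrArg (LinearMap.ker φ).subtype (b.sum_repr v)
          rw [map_sum] at this
          exact this.symm
        rw [hv, c.repr_sum_self]
      have hsmall (v : LinearMap.ker φ) (hv : ∀ i, ‖b.repr v i‖ < ε) (i : Fin (n + 1)) :
          ‖c.repr (v : V) i‖ < ε := by
        rw [hrepr]
        refine Fin.cases ?_ (fun i => ?_) i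
        · simpa using hε
        · simpa using hv i
      refine ⟨c, fun i j => ?_⟩
      refine Fin.cases ?_ (fun j => ?_) j
      · have : f (c 0) - (Fin.cons μ d : Fin (n + 1) → ℂ) 0 • c 0 =
            (((t : ℂ) • w : LinearMap.ker φ) : V) := by
          rw [hc0, map_smul, Fin.cons_zero, smul_comm μ, ← smul_sub]
          rfl
        rw [this]
        refine hsmall _ (fun i => ?_) i
        rw [map_smul, Finsupp.smul_apply, norm_smul, Complex.norm_of_nonneg ht0.le]
        exact ht i
      · have : f (c j.succ) - (Fin.cons μ d : Fin (n + 1) → ℂ) j.succ • c j.succ =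
            ((f.restrict hinv (b j) - d j • b j : LinearMap.ker φ) : V) := by
          simp [hcs]
        rw [this]
        exact hsmall _ (fun i => hb i j) i

theorem parabolaBlock_diagonal_posDef {m : Type*} [Fintype m] [DecidableEq m] (s q : ℝ)
    {d : m → ℂ} (hd : ∀ i, s ^ 2 * (d i).im ^ 2 < (d i).re - q) :
    (parabolaBlock s q (diagonal d) 1).PosDef := by
  let L : Matrix m m ℂ := diagonal fun i => Complex.I * s * (d i).im
  let e : m → ℂ := fun i => ((d i).re - q - s ^ 2 * (d i).im ^ 2 : ℝ)
  have hfactor : parabolaBlock s q (diagonal d) 1 =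
      fromBlocks 1 0 L 1 * diagonal (Sum.elim 1 e) * (fromBlocks 1 0 L 1)ᴴ := by
    rw [← fromBlocks_diagonal, fromBlocks_conjTranspose, fromBlocks_multiply, fromBlocks_multiply,
      parabolaBlock]
    simp only [diagonal_conjTranspose, L, diagonal_mul_diagonal, Pi.one_def, diagonal_one,
      Matrix.mul_one, Matrix.one_mul, Matrix.mul_zero, Matrix.zero_mul, add_zero, zero_add,
      conjTranspose_one, conjTranspose_zero]
    congr 1 <;> ext i j <;> obtain rfl | hij := eq_or_ne i j <;> apply Complex.ext <;>
      simp [e, pow_two, *] <;> ring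
  rw [hfactor]
  refine (PosDef.diagonal fun i => ?_).mul_mul_conjTranspose_same (vecMul_injective_of_isUnit ?_)
  · rcases i with i | i
    · simp
    · simpa [e, -Complex.ofReal_sub] using hd i
  · simp [isUnit_iff_isUnit_det]

theorem exists_parabolaBlock_posDef {n : ℕ} (s q : ℝ) (A : Matrix (Fin n) (Fin n) ℂ)
    (hA : ∀ z : ℂ, A.charpoly.IsRoot z → s ^ 2 * z.im ^ 2 < z.re - q) :
    ∃ X : Matrix (Fin n) (Fin n) ℂ, (parabolaBlock s q A X).PosDef := by
  obtain ⟨d, hd, hb⟩ := Module.End.exists_basis_near_diagonal (V := Fin n → ℂ) (n := n)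
    (by simp) (Matrix.toLin' A)
  have hd' (i : Fin n) : s ^ 2 * (d i).im ^ 2 < (d i).re - q := by
    apply hA
    have := (Module.End.hasEigenvalue_iff_isRoot_charpoly _ _).1 (hd i)
    simpa using this
  have hev : ∀ᶠ B : Fin n → Fin n → ℂ in nhds (diagonal d : Matrix (Fin n) (Fin n) ℂ),
      (parabolaBlock s q (of B) 1).PosDef := by
    refine PosDef.eventually_posDef ?_ (fun B => parabolaBlock_isHermitian _ _ _ isHermitian_one)
      (parabolaBlock_diagonal_posDef s q hd')
    unfold parabolaBlock
    have : Continuous fun B : Fin n → Fin n → ℂ => of B := continuous_id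
    fun_prop
  obtain ⟨ε, hε, hball⟩ := Metric.eventually_nhds_iff.1 hev
  obtain ⟨b, hb⟩ := hb ε hε
  let T : Matrix (Fin n) (Fin n) ℂ := (Pi.basisFun ℂ (Fin n)).toMatrix b
  let B : Matrix (Fin n) (Fin n) ℂ := LinearMap.toMatrix b b (Matrix.toLin' A)
  have hAT : A * T = T * B := by
    have h1 := linearMap_toMatrix_mul_basis_toMatrix b (Pi.basisFun ℂ (Fin n))
      (Pi.basisFun ℂ (Fin n)) (Matrix.toLin' A)
    have h2 := basis_toMatrix_mul_linearMap_toMatrix b (Pi.basisFun ℂ (Fin n)) b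
      (Matrix.toLin' A)
    rw [LinearMap.toMatrix_eq_toMatrix', LinearMap.toMatrix'_toLin'] at h1
    exact h1.trans h2.symm
  have hB : (parabolaBlock s q B 1).PosDef := by
    refine hball (y := B) ((dist_pi_lt_iff hε).2 fun i => (dist_pi_lt_iff hε).2 fun j => ?_)
    have := hb i j
    rw [dist_eq_norm]
    rw [map_sub, map_smul, Finsupp.sub_apply, Finsupp.smul_apply, b.repr_self] at this
    have hBij : B i j = b.repr (Matrix.toLin' A (b j)) i := LinearMap.toMatrix_apply b b _ i j
    have hdij : diagonal d i j = d j • Finsupp.single j (1 : ℂ) i := by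
      obtain rfl | hij := eq_or_ne i j <;> simp [*]
    rwa [hBij, hdij]
  have hT : IsUnit T := by
    have := (Pi.basisFun ℂ (Fin n)).invertibleToMatrix b
    exact isUnit_of_invertible T
  refine ⟨T * Tᴴ, ?_⟩
  rw [parabolaBlock_conj s q hAT]
  refine hB.mul_mul_conjTranspose_same (vecMul_injective_of_isUnit ?_)
  rw [isUnit_iff_isUnit_det, det_fromBlocks_zero₂₁]
  rw [isUnit_iff_isUnit_det] at hT
  exact hT.mul hT

theorem lt_of_parabolaBlock_posDef {m : Type*} [Fintype m] [DecidableEq m] {s q : ℝ}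
    {A X : Matrix m m ℂ} (h : (parabolaBlock s q A X).PosDef) {z : ℂ}
    (hz : A.charpoly.IsRoot z) : s ^ 2 * z.im ^ 2 < z.re - q := by
  have hX : X.PosDef := h.submatrix Sum.inl_injective
  have hdet : (scalar m z - A).det = 0 := by
    rw [← eval_charpoly]; exact hz
  obtain ⟨u, hu, huA⟩ := exists_vecMul_eq_zero_iff.2 hdet
  have huA' : u ᵥ* A = z • u := by
    rw [vecMul_sub, sub_eq_zero] at huA
    rw [← huA]
    simp [← smul_one_eq_diagonal, vecMul_smul]
  obtain ⟨w, rfl⟩ : ∃ w, u = star w := ⟨star u, (star_star u).symm⟩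
  have hw : w ≠ 0 := by rintro rfl; simp at hu
  have hAw : Aᴴ *ᵥ w = star z • w := by
    have := congrArg star huA'
    rwa [star_vecMul, star_star, star_smul, star_star] at this
  have hp := hX.re_dotProduct_pos hw
  have himp : (star w ⬝ᵥ X *ᵥ w).im = 0 := hX.1.im_star_dotProduct_mulVec_self w
  have hAX : star w ⬝ᵥ (A * X) *ᵥ w = z * (star w ⬝ᵥ X *ᵥ w) := by
    rw [← mulVec_mulVec, dotProduct_mulVec, huA', smul_dotProduct, smul_eq_mul]
  have hXA : star w ⬝ᵥ (X * Aᴴ) *ᵥ w = star z * (star w ⬝ᵥ X *ᵥ w) := by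
    rw [← mulVec_mulVec, hAw, mulVec_smul, dotProduct_smul, smul_eq_mul]
  let α : ℂ := Complex.I * s * z.im
  have hx : Sum.elim (α • w) w ≠ 0 := fun h => hw (by
    ext i
    simpa using congrFun h (Sum.inr i))
  have key := h.re_dotProduct_pos hx
  have hstar : star (Sum.elim (α • w) w) = Sum.elim (star α • star w) (star w) := by
    ext (i | i) <;> simp
  rw [parabolaBlock, fromBlocks_mulVec, hstar, sumElim_dotProduct_sumElim] at key
  simp only [Sum.elim_comp_inl, Sum.elim_comp_inr, dotProduct_add, smul_dotProduct, mulVec_smul,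
    dotProduct_smul, neg_mulVec, smul_mulVec, sub_mulVec, add_mulVec, dotProduct_sub,
    dotProduct_neg, hAX, hXA] at key
  generalize star w ⬝ᵥ X *ᵥ w = p at *
  obtain ⟨p, p'⟩ := p
  obtain rfl : p' = 0 := himp
  simp [α] at key hp
  have : 0 < p * (z.re - q - s ^ 2 * z.im ^ 2) := by linarith
  linarith [pos_of_mul_pos_right this hp.le]

end

theorem parabolaBlock_map_re {m : Type*} [Fintype m] (s q : ℝ) (A : Matrix m m ℝ)
    (X : Matrix m m ℂ) :
    (parabolaBlock s q (A.map Complex.ofReal) X).map Complex.re =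
      parabolaBlock s q A (X.map Complex.re) := by
  have h1 : (A.map Complex.ofReal * X).map Complex.re = A * X.map Complex.re := by
    ext i j
    simp [mul_apply]
  have h2 : (X * (A.map Complex.ofReal)ᴴ).map Complex.re = X.map Complex.re * Aᴴ := by
    ext i j
    simp [mul_apply]
  rw [parabolaBlock, parabolaBlock, fromBlocks_map, ← h1, ← h2]
  congr 1 <;> ext <;> simp

theorem parabolaBlock_map_ofReal {m : Type*} [Fintype m] (s q : ℝ) (A X : Matrix m m ℝ) :
    (parabolaBlock s q A X).map Complex.ofReal =
      parabolaBlock s q (A.map Complex.ofReal) (X.map Complex.ofReal) := by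
  have h1 : (A * X).map Complex.ofReal = A.map Complex.ofReal * X.map Complex.ofReal := by
    ext i j
    simp [mul_apply]
  have h2 : (X * Aᴴ).map Complex.ofReal = X.map Complex.ofReal * (A.map Complex.ofReal)ᴴ := by
    ext i j
    simp [mul_apply]
  rw [parabolaBlock, parabolaBlock, fromBlocks_map, ← h1, ← h2]
  congr 1 <;> ext <;> simp

/-- DH characterization of matrices with all eigenvalues in the right parabolic region
`{x + iy : y² < (2/c_p)(x - q_p)}`. -/
theorem right_parabola_stable_iff_DH {n : ℕ} (qp cp : ℝ) (hcp : 0 < cp)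
    (A : Matrix (Fin n) (Fin n) ℝ) :
    (∀ z : ℂ, ((A.map Complex.ofReal).charpoly).IsRoot z →
      z.im ^ 2 < (2 / cp) * (z.re - qp))
    ↔ ∃ J R Q : Matrix (Fin n) (Fin n) ℝ, Jᵀ = -J ∧ Rᵀ = R ∧ Q.PosDef ∧
        A = (J - R) * Q ∧
        (Matrix.fromBlocks
          Q⁻¹ (-(Real.sqrt (cp / 2)) • J)
          (Real.sqrt (cp / 2) • J) ((-qp) • Q⁻¹ - R)).PosDef := by
  set s := Real.sqrt (cp / 2) with hs
  have hregion (z : ℂ) :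
      z.im ^ 2 < (2 / cp) * (z.re - qp) ↔ s ^ 2 * z.im ^ 2 < z.re - qp := by
    rw [hs, Real.sq_sqrt (by positivity), div_mul_eq_mul_div, div_mul_eq_mul_div,
      lt_div_iff₀ hcp, div_lt_iff₀ two_pos, mul_comm cp, mul_comm 2]
  simp only [hregion]
  constructor
  · intro hA
    obtain ⟨X, hX⟩ := exists_parabolaBlock_posDef s qp _ hA
    have hY := hX.map_re
    rw [parabolaBlock_map_re] at hY
    generalize X.map Complex.re = Y at hY
    have hYpos : Y.PosDef := hY.submatrix Sum.inl_injective
    have hYt : Yᵀ = Y := hYpos.1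
    have hYunit : IsUnit Y.det := (isUnit_iff_isUnit_det _).1 hYpos.isUnit
    refine ⟨(1 / 2 : ℝ) • (A * Y - Y * Aᵀ), -((1 / 2 : ℝ) • (A * Y + Y * Aᵀ)), Y⁻¹, ?_, ?_,
      hYpos.inv, ?_, ?_⟩
    · simp [hYt, ← smul_neg]
    · simp [hYt, add_comm]
    · have : (1 / 2 : ℝ) • (A * Y - Y * Aᵀ) - -((1 / 2 : ℝ) • (A * Y + Y * Aᵀ)) = A * Y := by
        module
      rw [this, Matrix.mul_assoc, mul_nonsing_inv _ hYunit, Matrix.mul_one]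
    · rw [nonsing_inv_nonsing_inv _ hYunit]
      convert hY using 1
      rw [parabolaBlock, conjTranspose_eq_transpose_of_trivial]
      congr 1 <;> module
  · rintro ⟨J, R, Q, hJ, hR, hQ, rfl, hblock⟩ z hz
    have hQunit : IsUnit Q.det := (isUnit_iff_isUnit_det _).1 hQ.isUnit
    have hQt : Qᵀ = Q := hQ.1
    refine lt_of_parabolaBlock_posDef (X := Q⁻¹.map Complex.ofReal) ?_ hz
    rw [← parabolaBlock_map_ofReal]
    refine PosDef.map_ofReal ?_
    convert hblock using 1
    rw [parabolaBlock, conjTranspose_eq_transpose_of_trivial, transpose_mul, transpose_sub, hJ, hR,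
      hQt, Matrix.mul_assoc, mul_nonsing_inv _ hQunit, ← Matrix.mul_assoc,
      nonsing_inv_mul _ hQunit, Matrix.mul_one, Matrix.one_mul]
    congr 1 <;> module
end

section
/- Let Ω ⊆ ℂ be an extended LMI region determined by a complex Hermitian m×m matrix B and a complex m×m matrix C, i.e. Ω = {z ∈ ℂ : B + zC + conj(z)C* is negative definite}, where C* denotes the conjugate transpose. A complex n×n matrix A has all of its eigenvalues in Ω if and only if there exists a complex Hermitian n×n matrix X that is positive definite and such that the complex Hermitian nm×nm matrix B ⊗ X + C ⊗ (AX) + C* ⊗ (AX)* is negative definite (⊗ is the Kronecker product). -/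
open Matrix Kronecker
open scoped ComplexOrder

/-- The quadratic form of a Kronecker product factors on elementary tensors. -/
theorem Matrix.star_dotProduct_kronecker_mulVec {ι κ : Type*} [Fintype ι] [Fintype κ]
    (P : Matrix ι ι ℂ) (Q : Matrix κ κ ℂ) (u : ι → ℂ) (v : κ → ℂ) :
    star (fun p : ι × κ => u p.1 * v p.2) ⬝ᵥ ((P ⊗ₖ Q) *ᵥ fun p : ι × κ => u p.1 * v p.2) =
      (star u ⬝ᵥ (P *ᵥ u)) * (star v ⬝ᵥ (Q *ᵥ v)) := by
  have h : ((P ⊗ₖ Q) *ᵥ fun p : ι × κ => u p.1 * v p.2) =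
      fun p : ι × κ => (P *ᵥ u) p.1 * (Q *ᵥ v) p.2 := by
    ext ⟨i, j⟩
    simp only [mulVec, dotProduct, kroneckerMap_apply, Fintype.sum_prod_type,
      Finset.sum_mul_sum]
    exact Finset.sum_congr rfl fun _ _ => Finset.sum_congr rfl fun _ _ => by ring
  rw [h]
  simp only [dotProduct, Fintype.sum_prod_type, Finset.sum_mul_sum, Pi.star_apply, star_mul']
  exact Finset.sum_congr rfl fun _ _ => Finset.sum_congr rfl fun _ _ => by ring

theorem Matrix.PosDef.blockDiagonal {ι κ : Type*} [Fintype ι] [Fintype κ] [DecidableEq κ]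
    {M : κ → Matrix ι ι ℂ} (hM : ∀ k, (M k).PosDef) : (Matrix.blockDiagonal M).PosDef := by
  refine .of_dotProduct_mulVec_pos ?_ fun {x} hx => ?_
  · rw [IsHermitian, blockDiagonal_conjTranspose]
    exact congrArg _ (funext fun k => (hM k).isHermitian)
  · have h : star x ⬝ᵥ (Matrix.blockDiagonal M *ᵥ x) =
        ∑ k, star (fun i => x (i, k)) ⬝ᵥ (M k *ᵥ fun i => x (i, k)) := by
      simp only [dotProduct, mulVec, Fintype.sum_prod_type, blockDiagonal_apply, ite_mul, zero_mul,
        Finset.sum_ite_eq, Finset.mem_univ, if_true, Pi.star_apply]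
      exact Finset.sum_comm
    rw [h]
    obtain ⟨⟨i, k⟩, hik⟩ := Function.ne_iff.mp hx
    exact Finset.sum_pos' (fun k _ => (hM k).posSemidef.dotProduct_mulVec_nonneg _)
      ⟨k, Finset.mem_univ k, (hM k).dotProduct_mulVec_pos (Function.ne_iff.mpr ⟨i, hik⟩)⟩

/-- Positive definiteness is an open condition along continuous families of Hermitian matrices. -/
theorem Matrix.PosDef.eventually {ι E : Type*} [Fintype ι] [TopologicalSpace E]
    {N : E → Matrix ι ι ℂ} (hN : Continuous N) (hH : ∀ e, (N e).IsHermitian) {a : E}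
    (ha : (N a).PosDef) : ∀ᶠ e in nhds a, (N e).PosDef := by
  have hcont : Continuous fun p : E × (ι → ℂ) => (star p.2 ⬝ᵥ (N p.1 *ᵥ p.2)).re :=
    Complex.continuous_re.comp (Continuous.dotProduct continuous_snd.star
      ((hN.comp continuous_fst).matrix_mulVec continuous_snd))
  have hev : ∀ᶠ e in nhds a, ∀ x ∈ Metric.sphere (0 : ι → ℂ) 1,
      0 < (star x ⬝ᵥ (N e *ᵥ x)).re := by
    refine (isCompact_sphere 0 1).eventually_forall_of_forall_eventually fun x hx => ?_
    exact hcont.continuousAt.eventually_const_lt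
      (ha.re_dotProduct_pos (ne_zero_of_mem_unit_sphere ⟨x, hx⟩))
  filter_upwards [hev] with e he
  refine .of_dotProduct_mulVec_pos (hH e) fun {x} hx => ?_
  have hnorm : 0 < ‖x‖ := norm_pos_iff.mpr hx
  have hy := he ((‖x‖⁻¹ : ℂ) • x) (by simp [norm_smul, hnorm.ne'])
  have hre : 0 < (star x ⬝ᵥ (N e *ᵥ x)).re := by
    have hs : star ((‖x‖⁻¹ : ℂ) • x) ⬝ᵥ (N e *ᵥ ((‖x‖⁻¹ : ℂ) • x)) =
        ((‖x‖⁻¹ * ‖x‖⁻¹ : ℝ) : ℂ) * (star x ⬝ᵥ (N e *ᵥ x)) := by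
      simp [mulVec_smul, mul_assoc]
    rw [hs, Complex.re_ofReal_mul] at hy
    exact pos_of_mul_pos_right hy (by positivity)
  exact Complex.pos_iff.mpr ⟨hre, ((hH e).im_star_dotProduct_mulVec_self x).symm⟩

/-- Every endomorphism of a finite-dimensional complex space is lower triangular in some basis. -/
theorem Module.End.exists_basis_lowerTriangular (n : ℕ) : ∀ (V : Type) [AddCommGroup V]
    [Module ℂ V] [FiniteDimensional ℂ V], Module.finrank ℂ V = n → ∀ f : Module.End ℂ V,
    ∃ b : Module.Basis (Fin n) ℂ V, ∀ i j, i < j → b.repr (f (b j)) i = 0 := by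
  induction n with
  | zero =>
    intro V _ _ _ hV f
    exact ⟨Module.finBasisOfFinrankEq ℂ V hV, fun i => i.elim0⟩
  | succ n ih =>
    intro V _ _ _ hV f
    have : Nontrivial V := Module.nontrivial_of_finrank_pos (R := ℂ) (by omega)
    obtain ⟨μ, hμ⟩ := Module.End.exists_eigenvalue f
    have hr : LinearMap.range (f - algebraMap ℂ (Module.End ℂ V) μ) ≠ ⊤ := by
      rw [Ne, LinearMap.range_eq_top, ← LinearMap.injective_iff_surjective, ← LinearMap.ker_eq_bot]
      rwa [Module.End.hasEigenvalue_iff, Module.End.eigenspace_def,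
      ← Algebra.algebraMap_eq_smul_one] at hμ
    obtain ⟨W, hW, hle⟩ := (eq_top_or_exists_le_coatom _).resolve_left hr
    have hinv : ∀ w ∈ W, f w ∈ W := fun w hw => by
      have h := W.add_mem (hle ⟨w, rfl⟩) (W.smul_mem μ hw)
      simpa using h
    obtain ⟨y, -, hy⟩ := SetLike.exists_of_lt hW.lt_top
    have hsup : W ⊔ ℂ ∙ y = ⊤ := hW.2 _ (left_lt_sup.mpr fun h => hy (by simpa using h))
    have hli : ∀ (c : ℂ), ∀ x ∈ W, c • y + x = 0 → c = 0 := fun c x hx h => by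
      by_contra hc
      refine hy ((W.smul_mem_iff hc).mp ?_)
      rw [eq_neg_of_add_eq_zero_left h]
      exact W.neg_mem hx
    have hsp : ∀ z : V, ∃ c : ℂ, z + c • y ∈ W := fun z => by
      obtain ⟨w, hw, s, hs, rfl⟩ := Submodule.mem_sup.mp (hsup ▸ Submodule.mem_top : z ∈ W ⊔ ℂ ∙ y)
      obtain ⟨c, rfl⟩ := Submodule.mem_span_singleton.mp hs
      exact ⟨-c, by simpa using hw⟩
    have hWn : Module.finrank ℂ W = n := by
      have h := Module.finrank_eq_card_basis
        (Module.Basis.mkFinCons y (Module.finBasis ℂ W) hli hsp)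
      rw [hV, Fintype.card_fin] at h
      omega
    obtain ⟨b, hb⟩ := ih W hWn (f.restrict hinv)
    let b' := Module.Basis.mkFinCons y b hli hsp
    have hsucc : ∀ k, b' (Fin.succ k) = b k := fun k => by
      simp [b', Module.Basis.coe_mkFinCons]
    have hrepr : ∀ w : W, b'.repr (w : V) = Finsupp.cons 0 (b.repr w) := fun w => by
      apply b'.repr.symm.injective
      rw [LinearEquiv.symm_apply_apply, Module.Basis.repr_symm_apply,
        Finsupp.linearCombination_apply, Finsupp.sum_fintype _ _ (by simp), Fin.sum_univ_succ]
      simp only [Finsupp.cons_zero, zero_smul, zero_add, Finsupp.cons_succ, hsucc]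
      have h := congrArg W.subtype (b.sum_repr w)
      rw [map_sum] at h
      simpa using h.symm
    refine ⟨b', fun i j hij => ?_⟩
    obtain ⟨k, rfl⟩ := Fin.exists_succ_eq.mpr (Fin.ne_zero_of_lt hij)
    rw [hsucc]
    have h := hrepr (f.restrict hinv (b k))
    rw [LinearMap.coe_restrict_apply] at h
    rw [h]
    cases i using Fin.cases with
    | zero => simp
    | succ i => simpa using hb i k (Fin.succ_lt_succ_iff.mp hij)

theorem Matrix.exists_mul_eq_mul_lowerTriangular {n : ℕ} (A : Matrix (Fin n) (Fin n) ℂ) :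
    ∃ S T : Matrix (Fin n) (Fin n) ℂ, IsUnit S ∧ A * S = S * T ∧ (∀ i j, i < j → T i j = 0) ∧
      T.charpoly = A.charpoly := by
  obtain ⟨b, hb⟩ := Module.End.exists_basis_lowerTriangular n (Fin n → ℂ) (by simp)
    (Matrix.toLin' A)
  refine ⟨Matrix.of fun i j => b j i, LinearMap.toMatrix b b (Matrix.toLin' A), ?_, ?_, ?_, ?_⟩
  · rw [← Matrix.linearIndependent_cols_iff_isUnit]
    exact b.linearIndependent
  · ext i j
    have h := congrFun (b.sum_repr (Matrix.toLin' A (b j))) i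
    rw [Finset.sum_apply] at h
    simp only [Pi.smul_apply, smul_eq_mul] at h
    simp only [mul_apply, of_apply, LinearMap.toMatrix_apply]
    rw [Matrix.toLin'_apply, mulVec, dotProduct] at h
    rw [← h]
    exact Finset.sum_congr rfl fun _ _ => mul_comm _ _
  · intro i j hij
    simpa [LinearMap.toMatrix_apply] using hb i j hij
  · rw [LinearMap.charpoly_toMatrix, Matrix.charpoly_toLin']

theorem Matrix.isRoot_charpoly_diag_of_lowerTriangular {n : ℕ} {T : Matrix (Fin n) (Fin n) ℂ}
    (hT : ∀ i j, i < j → T i j = 0) (k : Fin n) : T.charpoly.IsRoot (T k k) := by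
  rw [Polynomial.IsRoot, Matrix.eval_charpoly, Matrix.det_of_isLowerTriangular]
  · exact Finset.prod_eq_zero (Finset.mem_univ k) (by simp)
  · intro i j hij
    have hij : i < j := hij
    simp [hT i j hij, hij.ne]

theorem Matrix.isHermitian_neg_kronecker_lmi {ι κ : Type*} {B : Matrix ι ι ℂ}
    (hB : B.IsHermitian) (C : Matrix ι ι ℂ) {X : Matrix κ κ ℂ} (hX : X.IsHermitian)
    (Y : Matrix κ κ ℂ) : (-(B ⊗ₖ X + C ⊗ₖ Y + Cᴴ ⊗ₖ Yᴴ)).IsHermitian := by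
  rw [IsHermitian, conjTranspose_neg, conjTranspose_add, conjTranspose_add,
    conjTranspose_kronecker, conjTranspose_kronecker, conjTranspose_kronecker, hB.eq, hX.eq,
    conjTranspose_conjTranspose, conjTranspose_conjTranspose]
  abel

theorem Matrix.posDef_neg_kronecker_lmi_diagonal {m n : ℕ} {B C : Matrix (Fin m) (Fin m) ℂ}
    {t : Fin n → ℂ}
    (ht : ∀ k, (-(B + t k • C + (starRingEnd ℂ (t k)) • Cᴴ)).PosDef) :
    (-(B ⊗ₖ (1 : Matrix (Fin n) (Fin n) ℂ) + C ⊗ₖ diagonal t + Cᴴ ⊗ₖ (diagonal t)ᴴ)).PosDef := by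
  convert Matrix.PosDef.blockDiagonal ht using 1
  ext ⟨i, k⟩ ⟨j, l⟩
  by_cases h : k = l
  · subst h
    simp [blockDiagonal_apply, mul_comm]
  · simp [blockDiagonal_apply, h]

/-- The congruence by an invertible `P` with `A P = P T` carries the LMI for `T` at `X = 1` to the
LMI for `A` at `X = P P*`. -/
theorem Matrix.PosDef.neg_kronecker_lmi_conj {m n : ℕ} {B C : Matrix (Fin m) (Fin m) ℂ}
    {A P T : Matrix (Fin n) (Fin n) ℂ} (hP : IsUnit P) (hAP : A * P = P * T)
    (h : (-(B ⊗ₖ (1 : Matrix (Fin n) (Fin n) ℂ) + C ⊗ₖ T + Cᴴ ⊗ₖ Tᴴ)).PosDef) :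
    (-(B ⊗ₖ (P * Pᴴ) + C ⊗ₖ (A * (P * Pᴴ)) + Cᴴ ⊗ₖ (A * (P * Pᴴ))ᴴ)).PosDef := by
  have hU : IsUnit ((1 : Matrix (Fin m) (Fin m) ℂ) ⊗ₖ P) := by
    rw [isUnit_iff_isUnit_det, det_kronecker]
    simpa using ((isUnit_iff_isUnit_det P).mp hP).pow m
  have hK : ∀ (D : Matrix (Fin m) (Fin m) ℂ) (Y : Matrix (Fin n) (Fin n) ℂ),
      D ⊗ₖ (P * Y * Pᴴ) = ((1 : Matrix (Fin m) (Fin m) ℂ) ⊗ₖ P) * (D ⊗ₖ Y) *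
        star ((1 : Matrix (Fin m) (Fin m) ℂ) ⊗ₖ P) := fun D Y => by
    rw [star_eq_conjTranspose, conjTranspose_kronecker, ← mul_kronecker_mul, ← mul_kronecker_mul]
    simp
  have h1 : A * (P * Pᴴ) = P * T * Pᴴ := by rw [← Matrix.mul_assoc, hAP]
  have h2 : (P * T * Pᴴ)ᴴ = P * Tᴴ * Pᴴ := by
    simp [conjTranspose_mul, Matrix.mul_assoc]
  have h3 : P * Pᴴ = P * 1 * Pᴴ := by simp
  rw [h1, h2, h3, hK, hK, hK, ← Matrix.add_mul, ← Matrix.add_mul, ← Matrix.mul_add,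
    ← Matrix.mul_add, ← Matrix.neg_mul, ← Matrix.mul_neg]
  exact (Matrix.IsUnit.posDef_star_right_conjugate_iff hU).mpr h

/-- Stability implies feasibility of the LMI: after triangularization, a diagonal scaling makes the
strictly lower triangular part arbitrarily small. -/
theorem Matrix.exists_posDef_lmi_of_forall_isRoot {m n : ℕ} {B : Matrix (Fin m) (Fin m) ℂ}
    (C : Matrix (Fin m) (Fin m) ℂ) (hB : B.IsHermitian) (A : Matrix (Fin n) (Fin n) ℂ)
    (h : ∀ z : ℂ, A.charpoly.IsRoot z → (-(B + z • C + (starRingEnd ℂ z) • Cᴴ)).PosDef) :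
    ∃ P : Matrix (Fin n) (Fin n) ℂ, IsUnit P ∧
      (-(B ⊗ₖ (P * Pᴴ) + C ⊗ₖ (A * (P * Pᴴ)) + Cᴴ ⊗ₖ (A * (P * Pᴴ))ᴴ)).PosDef := by
  obtain ⟨S, T, hS, hAS, hT, hchar⟩ := Matrix.exists_mul_eq_mul_lowerTriangular A
  let R : ℂ → Matrix (Fin n) (Fin n) ℂ := fun e => Matrix.of fun i j => e ^ (i - j : ℕ) * T i j
  have hR0 : R 0 = diagonal fun k => T k k := by
    ext i j
    rcases lt_trichotomy i j with hij | rfl | hij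
    · simp [R, hT i j hij, hij.ne]
    · simp [R]
    · have : (i - j : ℕ) ≠ 0 := Nat.sub_ne_zero_of_lt hij
      simp [R, this, hij.ne']
  have hRc : Continuous R := by
    refine continuous_matrix fun i j => ?_
    simp only [R, of_apply]
    fun_prop
  have hNc : Continuous fun e => -(B ⊗ₖ (1 : Matrix (Fin n) (Fin n) ℂ) + C ⊗ₖ R e +
      Cᴴ ⊗ₖ (R e)ᴴ) := by
    refine continuous_matrix fun p q => ?_
    simp only [neg_apply, add_apply, kroneckerMap_apply, conjTranspose_apply]
    have := fun i j => hRc.matrix_elem i j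
    fun_prop
  have hN0 : (-(B ⊗ₖ (1 : Matrix (Fin n) (Fin n) ℂ) + C ⊗ₖ R 0 + Cᴴ ⊗ₖ (R 0)ᴴ)).PosDef := by
    rw [hR0]
    refine Matrix.posDef_neg_kronecker_lmi_diagonal fun k => h _ ?_
    rw [← hchar]
    exact Matrix.isRoot_charpoly_diag_of_lowerTriangular hT k
  have hev := Matrix.PosDef.eventually hNc
    (fun e => Matrix.isHermitian_neg_kronecker_lmi hB C isHermitian_one (R e)) hN0
  obtain ⟨e, he, he0⟩ := ((hev.filter_mono nhdsWithin_le_nhds).and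
    (self_mem_nhdsWithin : {(0 : ℂ)}ᶜ ∈ nhdsWithin 0 {(0 : ℂ)}ᶜ)).exists
  have he0 : e ≠ 0 := he0
  let D : Matrix (Fin n) (Fin n) ℂ := diagonal fun i => (e ^ (i : ℕ))⁻¹
  have hD : IsUnit D := by
    rw [isUnit_iff_isUnit_det, det_diagonal, isUnit_iff_ne_zero, Finset.prod_ne_zero_iff]
    exact fun i _ => inv_ne_zero (pow_ne_zero _ he0)
  have hTD : T * D = D * R e := by
    ext i j
    simp only [D, R, mul_diagonal, diagonal_mul, of_apply]
    rcases lt_or_ge i j with hij | hij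
    · simp [hT i j hij]
    · have hp : e ^ (i : ℕ) = e ^ (i - j : ℕ) * e ^ (j : ℕ) := by
        rw [← pow_add, Nat.sub_add_cancel hij]
      rw [hp]
      field_simp
  refine ⟨S * D, hS.mul hD, Matrix.PosDef.neg_kronecker_lmi_conj (hS.mul hD) ?_ he⟩
  rw [← Matrix.mul_assoc, hAS, Matrix.mul_assoc, hTD, Matrix.mul_assoc]

theorem Matrix.posDef_neg_lmi_of_isRoot {m n : ℕ} {B : Matrix (Fin m) (Fin m) ℂ}
    {C : Matrix (Fin m) (Fin m) ℂ} (hB : B.IsHermitian) {A X : Matrix (Fin n) (Fin n) ℂ}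
    (hX : X.PosDef) (hM : (-(B ⊗ₖ X + C ⊗ₖ (A * X) + Cᴴ ⊗ₖ (A * X)ᴴ)).PosDef) {z : ℂ}
    (hz : A.charpoly.IsRoot z) : (-(B + z • C + (starRingEnd ℂ z) • Cᴴ)).PosDef := by
  rw [Polynomial.IsRoot, Matrix.eval_charpoly] at hz
  obtain ⟨w, hw0, hw⟩ := Matrix.exists_vecMul_eq_zero_iff.mpr hz
  obtain ⟨v, rfl⟩ : ∃ v, star v = w := ⟨star w, star_star w⟩
  have hv0 : v ≠ 0 := fun h => hw0 (by simp [h])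
  have hvA : star v ᵥ* A = z • star v := by
    rw [vecMul_sub, sub_eq_zero] at hw
    rw [← hw, scalar_apply, vecMul_diagonal_const]
    simp
  have hc := hX.dotProduct_mulVec_pos hv0
  have hAX : star v ⬝ᵥ ((A * X) *ᵥ v) = z * (star v ⬝ᵥ (X *ᵥ v)) := by
    rw [← mulVec_mulVec, dotProduct_mulVec, hvA, smul_dotProduct, smul_eq_mul]
  have hAX' : star v ⬝ᵥ ((A * X)ᴴ *ᵥ v) = starRingEnd ℂ z * (star v ⬝ᵥ (X *ᵥ v)) := by
    have h := congrArg star hAX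
    rw [star_mul', (IsSelfAdjoint.of_nonneg hc.le).star_eq] at h
    rw [starRingEnd_apply, ← h, star_dotProduct, star_mulVec, ← dotProduct_mulVec]
    simp
  refine .of_dotProduct_mulVec_pos ?_ fun {u} hu => ?_
  · rw [IsHermitian, conjTranspose_neg, conjTranspose_add, conjTranspose_add, conjTranspose_smul,
      conjTranspose_smul, hB.eq, conjTranspose_conjTranspose]
    simp [add_right_comm]
  · have hne : (fun p : Fin m × Fin n => u p.1 * v p.2) ≠ 0 := by
      obtain ⟨i, hi⟩ := Function.ne_iff.mp hu
      obtain ⟨j, hj⟩ := Function.ne_iff.mp hv0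
      exact Function.ne_iff.mpr ⟨(i, j), mul_ne_zero hi hj⟩
    have hpos := hM.dotProduct_mulVec_pos hne
    simp only [neg_mulVec, add_mulVec, dotProduct_neg, dotProduct_add,
      star_dotProduct_kronecker_mulVec, hAX, hAX'] at hpos
    refine pos_of_mul_pos_left (b := star v ⬝ᵥ (X *ᵥ v)) ?_ hc.le
    convert hpos using 1
    simp only [neg_mulVec, add_mulVec, dotProduct_neg, dotProduct_add, smul_mulVec,
      dotProduct_smul, smul_eq_mul]
    ring

/-- Characterization of complex Ω-stability for an extended LMI region determined by a
Hermitian matrix `B` and a matrix `C`: all eigenvalues of `A` lie in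
`{z : B + z C + conj z C* ≺ 0}` iff there is a Hermitian positive definite `X` with
`B ⊗ X + C ⊗ (AX) + C* ⊗ (AX)* ≺ 0`. -/
theorem extended_lmi_region_stability_iff {m n : ℕ}
    (B C : Matrix (Fin m) (Fin m) ℂ) (hB : B.IsHermitian)
    (A : Matrix (Fin n) (Fin n) ℂ) :
    (∀ z : ℂ, (A.charpoly).IsRoot z →
      (-(B + z • C + (starRingEnd ℂ z) • Cᴴ)).PosDef)
    ↔ ∃ X : Matrix (Fin n) (Fin n) ℂ, X.IsHermitian ∧ X.PosDef ∧
        (-(B ⊗ₖ X + C ⊗ₖ (A * X) + Cᴴ ⊗ₖ (A * X)ᴴ)).PosDef := by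
  constructor
  · intro h
    obtain ⟨P, hP, hM⟩ := Matrix.exists_posDef_lmi_of_forall_isRoot C hB A h
    have hX : (P * Pᴴ).PosDef :=
      Matrix.PosDef.mul_conjTranspose_self P (vecMul_injective_iff_isUnit.mpr hP)
    exact ⟨P * Pᴴ, hX.isHermitian, hX, hM⟩
  · rintro ⟨X, -, hX, hM⟩ z hz
    exact Matrix.posDef_neg_lmi_of_isRoot hB hX hM hz
end
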